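/- Let G be a graph with spectral radius μ ≥ √20 and positive unit eigenvector x to μ. Suppose vertices u, v, w satisfy d(u) = d(w) = 2, d(v) = 3, and v is adjacent to both u and w. Then x_u·x_v < 1/(4μ) or x_w·x_v < 1/(4μ). -/

import Mathlib

open Matrix Finset

def IsSpecRad {n : ℕ} (A : Matrix (Fin n) (Fin n) ℝ) (μ : ℝ) : Prop :=
  Module.End.HasEigenvalue A.mulVecLin μ ∧
    ∀ ν : ℝ, Module.End.HasEigenvalue A.mulVecLin ν → ν ≤ μ

lemma key_ineq (n : ℕ) (G : SimpleGraph (Fin n)) [DecidableRel G.Adj] (μ : ℝ)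
    (x : Fin n → ℝ) (hpos : ∀ i, 0 < x i)
    (hx : (G.adjMatrix ℝ).mulVec x = μ • x)
    (hunit : ∑ i, (x i) ^ 2 = 1) (u v : Fin n) (huv : G.Adj v u)
    (H : Finset (Fin n)) (hu : u ∉ H) (hv : v ∉ H) :
    2 * μ * ∑ i ∈ H, x i ^ 2 + 2 * (x u * x v) ≤
      μ + ∑ i ∈ H, ∑ j ∈ H, G.adjMatrix ℝ i j * (x i * x j) := by
  set A := G.adjMatrix ℝ with hA
  have hA0 : ∀ i j, 0 ≤ A i j := by
    intro i j
    rw [hA, SimpleGraph.adjMatrix_apply]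
    split_ifs <;> norm_num
  have hsymm : ∀ i j, A i j = A j i := by
    intro i j
    simp only [hA, SimpleGraph.adjMatrix_apply, G.adj_comm]
  have hrow : ∀ i, ∑ j, A i j * x j = μ * x i := fun i => by
    have := congrFun hx i
    simpa [Matrix.mulVec, dotProduct] using this
  set g : Fin n → ℝ := fun i => if i ∈ H then 0 else x i with hg
  set f : Fin n → ℝ := fun i => if i ∈ H then x i else 0 with hf
  have hgf : ∀ i, g i = x i - f i := by
    intro i
    simp only [hg, hf]
    split_ifs <;> simp
  have hg0 : ∀ i, 0 ≤ g i := by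
    intro i
    simp only [hg]
    split_ifs
    · exact le_rfl
    · exact (hpos i).le
  have hvu : v ≠ u := huv.ne
  have hlow : 2 * (x u * x v) ≤ ∑ i, ∑ j, A i j * (g i * g j) := by
    have hT : ∀ i j, 0 ≤ A i j * (g i * g j) := fun i j =>
      mul_nonneg (hA0 i j) (mul_nonneg (hg0 i) (hg0 j))
    have h1 : ∑ i ∈ ({u, v} : Finset (Fin n)), ∑ j, A i j * (g i * g j) ≤
        ∑ i, ∑ j, A i j * (g i * g j) :=
      Finset.sum_le_sum_of_subset_of_nonneg (Finset.subset_univ _)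
        (fun i _ _ => Finset.sum_nonneg fun j _ => hT i j)
    rw [Finset.sum_pair hvu.symm] at h1
    have h2 := Finset.single_le_sum (f := fun j => A u j * (g u * g j))
      (fun j _ => hT u j) (Finset.mem_univ v)
    have h3 := Finset.single_le_sum (f := fun j => A v j * (g v * g j))
      (fun j _ => hT v j) (Finset.mem_univ u)
    have e1 : A u v = 1 := by simp [hA, huv.symm]
    have e2 : A v u = 1 := by simp [hA, huv]
    have e3 : g u = x u := by simp [hg, hu]
    have e4 : g v = x v := by simp [hg, hv]
    simp only [e1, e2, e3, e4] at h1 h2 h3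
    linarith
  have hexp : ∑ i, ∑ j, A i j * (g i * g j) =
      μ - 2 * μ * ∑ i, f i * x i + ∑ i, ∑ j, A i j * (f i * f j) := by
    have s1 : ∑ i, ∑ j, A i j * (x i * x j) = μ := by
      have : ∀ i, ∑ j, A i j * (x i * x j) = μ * x i ^ 2 := fun i => by
        calc _ = x i * ∑ j, A i j * x j := by
              rw [Finset.mul_sum]; exact Finset.sum_congr rfl fun j _ => by ring
          _ = _ := by rw [hrow]; ring
      simp only [this, ← Finset.mul_sum, hunit, mul_one]
    have s2 : ∑ i, ∑ j, A i j * (f i * x j) = μ * ∑ i, f i * x i := by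
      rw [Finset.mul_sum]
      refine Finset.sum_congr rfl fun i _ => ?_
      calc _ = f i * ∑ j, A i j * x j := by
              rw [Finset.mul_sum]; exact Finset.sum_congr rfl fun j _ => by ring
          _ = _ := by rw [hrow]; ring
    have s3 : ∑ i, ∑ j, A i j * (x i * f j) = μ * ∑ i, f i * x i := by
      rw [← s2, Finset.sum_comm]
      refine Finset.sum_congr rfl fun i _ => Finset.sum_congr rfl fun j _ => ?_
      rw [hsymm]; ring
    have : ∀ i j, A i j * (g i * g j) = A i j * (x i * x j) - A i j * (f i * x j)
        - A i j * (x i * f j) + A i j * (f i * f j) := by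
      intro i j; rw [hgf, hgf]; ring
    simp only [this, Finset.sum_add_distrib, Finset.sum_sub_distrib, s1, s2, s3]
    ring
  have e1 : ∑ i, f i * x i = ∑ i ∈ H, x i ^ 2 := by
    simp [hf, ite_mul, Finset.sum_ite_mem, sq]
  have e2 : ∑ i, ∑ j, A i j * (f i * f j) = ∑ i ∈ H, ∑ j ∈ H, A i j * (x i * x j) := by
    simp [hf, ite_mul, mul_ite, Finset.sum_ite_mem]
  rw [e1, e2] at hexp
  linarith

lemma quad_pos (A B C p q : ℝ) (hA : 0 < A) (h : B ^ 2 < 4 * A * C) (hq : 0 < q) :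
    0 < A * p ^ 2 - B * (p * q) + C * q ^ 2 := by
  have : 0 < 4 * A * (A * p ^ 2 - B * (p * q) + C * q ^ 2) := by
    have h1 : 0 < (4 * A * C - B ^ 2) * q ^ 2 := mul_pos (by linarith) (by positivity)
    nlinarith [sq_nonneg (2 * A * p - B * q)]
  exact pos_of_mul_pos_right this (by positivity)

lemma tri_case (m p q a c : ℝ) (hm : 4.472 ≤ m) (hq : 0 < q)
    (h1 : m * p = q + a) (h2 : m * q = p + a + c)
    (h : 2 * m * (a ^ 2 + c ^ 2) + 2 * (p * q) ≤ m + 2 * (a * c))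
    (hpq : m ≤ 4 * m ^ 2 * (p * q)) : False := by
  obtain ⟨t, ht, rfl⟩ : ∃ t, 0 ≤ t ∧ m = 4.472 + t := ⟨m - 4.472, by linarith, by ring⟩
  set m := 4.472 + t with hmt
  have ha : a = m * p - q := by linarith
  have hc : c = (m + 1) * (q - p) := by linarith
  have := quad_pos (2 * m * (m ^ 2 + (m + 1) ^ 2) + 2 * m * (m + 1))
    (4 * m ^ 2 + 4 * m * (m + 1) ^ 2 + 2 * (m + 1) ^ 2 + 4 * m ^ 2 - 2)
    (2 * m * (1 + (m + 1) ^ 2) + 2 * (m + 1)) p q (by positivity)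
    (by
      rw [← sub_pos, hmt]
      ring_nf
      positivity) hq
  rw [ha, hc] at h
  nlinarith

lemma gen_case (m p q a b c : ℝ) (hm : 4.472 ≤ m) (hq : 0 < q)
    (h1 : m * p = q + a) (h2 : m * q = p + b + c)
    (h : 2 * m * (a ^ 2 + b ^ 2 + c ^ 2) + 2 * (p * q) ≤ m + 2 * (a * b + b * c + a * c))
    (hpq : m ≤ 4 * m ^ 2 * (p * q)) : False := by
  have hs : 2 * m * a ^ 2 + (m - 1 / 2) * (b + c) ^ 2 + 2 * (p * q) ≤ m + 2 * (a * (b + c)) := by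
    nlinarith [mul_nonneg (by linarith : (0:ℝ) ≤ m) (sq_nonneg (b - c)), sq_nonneg (b - c)]
  obtain ⟨t, ht, rfl⟩ : ∃ t, 0 ≤ t ∧ m = 4.472 + t := ⟨m - 4.472, by linarith, by ring⟩
  set m := 4.472 + t with hmt
  have ha : a = m * p - q := by linarith
  have hc : b + c = m * q - p := by linarith
  have := quad_pos (2 * m ^ 3 + (m - 1 / 2) + 2 * m)
    (4 * m ^ 2 + 2 * m * (m - 1 / 2) + 2 * (m ^ 2 + 1) + 4 * m ^ 2 - 2)
    (2 * m + (m - 1 / 2) * m ^ 2 + 2 * m) p q (by rw [hmt]; ring_nf; positivity)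
    (by
      rw [← sub_pos, hmt]
      ring_nf
      positivity) hq
  rw [ha, hc] at hs
  nlinarith

theorem claim2 (n : ℕ) (G : SimpleGraph (Fin n)) [DecidableRel G.Adj] (μ : ℝ)
    (hμ : IsSpecRad (G.adjMatrix ℝ) μ) (hμ20 : μ ≥ Real.sqrt 20)
    (x : Fin n → ℝ) (hpos : ∀ i, 0 < x i)
    (hx : (G.adjMatrix ℝ).mulVec x = μ • x)
    (hunit : ∑ i, (x i) ^ 2 = 1)
    (u v w : Fin n)
    (hdu : G.degree u = 2) (hdw : G.degree w = 2) (hdv : G.degree v = 3)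
    (huv : G.Adj v u) (hvw : G.Adj v w) :
    x u * x v < 1 / (4 * μ) ∨ x w * x v < 1 / (4 * μ) := by
  left
  have hm : (4.472 : ℝ) ≤ μ := le_trans (Real.le_sqrt_of_sq_le (by norm_num)) hμ20
  have hm0 : 0 < μ := by linarith
  by_contra hcon
  push Not at hcon
  have hpq : μ ≤ 4 * μ ^ 2 * (x u * x v) := by
    rw [div_le_iff₀ (by positivity)] at hcon
    nlinarith
  have hrow : ∀ i, ∑ j ∈ G.neighborFinset i, x j = μ * x i := fun i => by
    have := congrFun hx i
    simpa [SimpleGraph.adjMatrix_mulVec_apply] using this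
  have hle : ∀ i j, G.adjMatrix ℝ i j * (x i * x j) ≤ x i * x j := by
    intro i j
    have := mul_pos (hpos i) (hpos j)
    rw [SimpleGraph.adjMatrix_apply]
    split_ifs <;> linarith
  have hdiag : ∀ i, G.adjMatrix ℝ i i = 0 := by intro i; simp
  -- neighbours of u
  have hNu : ((G.neighborFinset u).erase v).card = 1 := by
    rw [Finset.card_erase_of_mem (by simpa using huv.symm), G.card_neighborFinset_eq_degree, hdu]
  have hNv : ((G.neighborFinset v).erase u).card = 2 := by
    rw [Finset.card_erase_of_mem (by simpa using huv), G.card_neighborFinset_eq_degree, hdv]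
  obtain ⟨a, ha⟩ := Finset.card_eq_one.mp hNu
  obtain ⟨b, c, hbc, hb⟩ := Finset.card_eq_two.mp hNv
  have h1 : μ * x u = x v + x a := by
    rw [← hrow, ← Finset.add_sum_erase _ _ (show v ∈ G.neighborFinset u by simpa using huv.symm),
      ha, Finset.sum_singleton]
  have h2 : μ * x v = x u + x b + x c := by
    rw [← hrow, ← Finset.add_sum_erase _ _ (show u ∈ G.neighborFinset v by simpa using huv),
      hb, Finset.sum_pair hbc, add_assoc]
  have ma : a ∈ (G.neighborFinset u).erase v := by rw [ha]; simp
  have mb : b ∈ (G.neighborFinset v).erase u := by rw [hb]; simp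
  have mc : c ∈ (G.neighborFinset v).erase u := by rw [hb]; simp
  simp only [Finset.mem_erase, SimpleGraph.mem_neighborFinset] at ma mb mc
  have hau := ma.2.ne
  have hbv := mb.2.ne
  have hcv := mc.2.ne
  have tri : ∀ c', a ≠ c' → u ≠ c' → v ≠ c' → μ * x v = x u + x a + x c' → False := by
    intro c' hac huc hvc h2'
    have hk := key_ineq n G μ x hpos hx hunit u v huv {a, c'}
      (by simp [hau, huc]) (by simp [ma.1.symm, hvc])
    simp only [Finset.sum_pair hac, hdiag] at hk
    exact tri_case μ (x u) (x v) (x a) (x c') hm (hpos v) h1 h2'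
      (by linarith [hle a c', hle c' a, mul_comm (x a) (x c')]) hpq
  by_cases hab : a = b
  · exact tri c (hab ▸ hbc) mc.1.symm hcv (by rw [hab]; exact h2)
  by_cases hac : a = c
  · exact tri b hab mb.1.symm hbv (by rw [hac]; linarith)
  have hk := key_ineq n G μ x hpos hx hunit u v huv {a, b, c}
      (by simp [hau, mb.1.symm, mc.1.symm]) (by simp [ma.1.symm, hbv, hcv])
  have hn : a ∉ ({b, c} : Finset (Fin n)) := by simp [hab, hac]
  simp only [Finset.sum_insert hn, Finset.sum_pair hbc, hdiag] at hk
  exact gen_case μ (x u) (x v) (x a) (x b) (x c) hm (hpos v) h1 h2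
    (by linarith [hle a b, hle b a, hle a c, hle c a, hle b c, hle c b,
      mul_comm (x a) (x b), mul_comm (x a) (x c), mul_comm (x b) (x c)]) hpq
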